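/- For N = 2 (so the GOE expectation is over 3 ordered eigenvalues with density Q_3), and for positive constants a and b, E_{GOE}^3[exp(λ_3²/2 − a(λ_3 − b)²)] = (1/(√2 π)) { (1/a + 2b² − 1)(π/√a) Φ(b√(2a)/√(a+1)) + (b√(a+1)√π/a) e^{−ab²/(a+1)} + (2π/√(2a+1)) e^{−ab²/(2a+1)} Φ(√2 a b/√((2a+1)(a+1))) }. -/

import Mathlib

open MeasureTheory Real

noncomputable def goeK (q x : ℝ) : ℝ := ∫ t in Set.Iic x, Real.exp (-q * t ^ 2)

lemma goe_int {q : ℝ} (hq : 0 < q) (n : ℕ) :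
    Integrable (fun x : ℝ => x ^ n * Real.exp (-q * x ^ 2)) := by
  have := integrable_rpow_mul_exp_neg_mul_sq hq (s := n) (by have : (0:ℝ) ≤ n := by positivity
                                                             linarith)
  simpa using this

lemma goe_tendsto {q : ℝ} (hq : 0 < q) (n : ℕ) :
    Filter.Tendsto (fun x : ℝ => x ^ n * Real.exp (-q * x ^ 2)) (Filter.cocompact ℝ) (nhds 0) := by
  have := tendsto_rpow_abs_mul_exp_neg_mul_sq_cocompact hq n
  rw [tendsto_zero_iff_norm_tendsto_zero]
  refine this.congr fun x => ?_
  simp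

lemma goeK_hasDerivAt {q : ℝ} (hq : 0 < q) (x : ℝ) :
    HasDerivAt (goeK q) (Real.exp (-q * x ^ 2)) x := by
  have hi := integrable_exp_neg_mul_sq hq
  have h1 : goeK q = fun y => goeK q 0 + ∫ t in (0:ℝ)..y, Real.exp (-q * t ^ 2) := by
    funext y
    rw [← intervalIntegral.integral_Iic_sub_Iic hi.integrableOn hi.integrableOn]
    simp [goeK]
  rw [h1]
  have hc : Continuous fun t : ℝ => Real.exp (-q * t ^ 2) := by fun_prop
  exact (intervalIntegral.integral_hasDerivAt_right (hc.intervalIntegrable _ _)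
    (hc.stronglyMeasurableAtFilter _ _) hc.continuousAt).const_add _

lemma goeK_continuous {q : ℝ} (hq : 0 < q) : Continuous (goeK q) :=
  continuous_iff_continuousAt.2 fun x => (goeK_hasDerivAt hq x).continuousAt

lemma goeK_bound {q : ℝ} (hq : 0 < q) (x : ℝ) : ‖goeK q x‖ ≤ √(π / q) := by
  rw [← integral_gaussian]
  have hi := integrable_exp_neg_mul_sq hq
  rw [Real.norm_of_nonneg]
  · exact setIntegral_le_integral hi (Filter.Eventually.of_forall fun x => by positivity)
  · exact setIntegral_nonneg measurableSet_Iic fun x _ => by positivity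

lemma goeK_bot (q : ℝ) : Filter.Tendsto (goeK q) Filter.atBot (nhds 0) :=
  tendsto_integral_Iic_zero Filter.tendsto_id

lemma goeK_mul_tendsto {q : ℝ} (hq : 0 < q) {f : ℝ → ℝ} {l : Filter ℝ} (b : ℝ) {c : ℝ}
    (hf : Filter.Tendsto f l (nhds c)) (hc : c = 0) :
    Filter.Tendsto (fun x => f x * goeK q (x + b)) l (nhds 0) := by
  subst hc
  apply hf.zero_mul_isBoundedUnder_le
  exact Filter.isBoundedUnder_of ⟨_, fun x => goeK_bound hq (x + b)⟩

lemma goeK_mul_int {q : ℝ} (hq : 0 < q) {f : ℝ → ℝ} (b : ℝ) (hf : Integrable f) :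
    Integrable (fun x => f x * goeK q (x + b)) :=
  hf.mul_bdd ((goeK_continuous hq).comp (by fun_prop)).aestronglyMeasurable
    (Filter.Eventually.of_forall fun x => goeK_bound hq (x + b))

lemma goeK_phi (Φ : ℝ → ℝ)
    (hΦ : ∀ x, Φ x = ∫ t in Set.Iic x, (Real.sqrt (2 * π))⁻¹ * Real.exp (-t ^ 2 / 2))
    {r : ℝ} (hr : 0 < r) (x : ℝ) : goeK r x = √(π / r) * Φ (x * √(2 * r)) := by
  have hs : 0 < √(2 * r) := by positivity
  rw [hΦ, goeK, integral_const_mul, ← integral_indicator measurableSet_Iic,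
    ← integral_indicator measurableSet_Iic]
  have h := Measure.integral_comp_mul_left
    ((Set.Iic (x * √(2 * r))).indicator fun t : ℝ => Real.exp (-t ^ 2 / 2)) (√(2 * r))
  have h2 : ∀ y : ℝ, (Set.Iic (x * √(2 * r))).indicator (fun t : ℝ => Real.exp (-t ^ 2 / 2)) (√(2 * r) * y)
      = (Set.Iic x).indicator (fun t : ℝ => Real.exp (-r * t ^ 2)) y := by
    intro y
    have : √(2 * r) * y ≤ x * √(2 * r) ↔ y ≤ x := by
      rw [mul_comm]; exact mul_le_mul_iff_left₀ hs
    have e : -(√(2 * r) * y) ^ 2 / 2 = -r * y ^ 2 := by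
      rw [mul_pow, Real.sq_sqrt (by positivity)]; ring
    simp only [Set.indicator, Set.mem_Iic, this, e]
  simp only [h2] at h
  rw [h, abs_of_pos (by positivity), smul_eq_mul, ← mul_assoc]
  congr 1
  rw [Real.sqrt_div pi_pos.le, Real.sqrt_mul (by norm_num), Real.sqrt_mul (by norm_num)]
  have h3 : √2 * √2 = 2 := Real.mul_self_sqrt (by norm_num)
  field_simp

lemma goe_sq_int {p q : ℝ} (hp : 0 < p) (hq : 0 < q) (w : ℝ) :
    ∫ u : ℝ, Real.exp (-p * u ^ 2) * Real.exp (-q * (w + u) ^ 2)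
      = √(π / (p + q)) * Real.exp (-(p * q / (p + q)) * w ^ 2) := by
  have : ∀ u : ℝ, Real.exp (-p * u ^ 2) * Real.exp (-q * (w + u) ^ 2)
      = Real.exp (-(p + q) * (u + q * w / (p + q)) ^ 2) * Real.exp (-(p * q / (p + q)) * w ^ 2) := by
    intro u
    rw [← Real.exp_add, ← Real.exp_add]
    congr 1
    have : p + q ≠ 0 := by positivity
    field_simp
    ring
  simp only [this]
  rw [integral_mul_const, integral_add_right_eq_self (fun u => Real.exp (-(p + q) * u ^ 2)),
    integral_gaussian]

lemma goe_key {p q : ℝ} (hp : 0 < p) (hq : 0 < q) (m : ℝ) :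
    ∫ u : ℝ, Real.exp (-p * u ^ 2) * goeK q (u + m)
      = √(π / (p + q)) * goeK (p * q / (p + q)) m := by
  have h1 : ∀ u : ℝ, Real.exp (-p * u ^ 2) * goeK q (u + m)
      = ∫ w in Set.Iic m, Real.exp (-p * u ^ 2) * Real.exp (-q * (w + u) ^ 2) := by
    intro u
    rw [integral_const_mul]
    congr 1
    rw [goeK, ← integral_indicator measurableSet_Iic, ← integral_indicator measurableSet_Iic,
      ← integral_add_right_eq_self _ u]
    congr 1
    funext w
    have : w + u ≤ u + m ↔ w ≤ m := by constructor <;> intro h <;> linarith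
    simp only [Set.indicator, Set.mem_Iic, this]
  simp only [h1]
  rw [integral_integral_swap]
  · simp only [goe_sq_int hp hq]
    rw [integral_const_mul, goeK]
  · have h := (integrable_exp_neg_mul_sq hp).mul_prod (integrable_exp_neg_mul_sq hq)
    have h2 := ((measurePreserving_prod_add (volume : Measure ℝ) (volume : Measure ℝ)).integrable_comp
      h.aestronglyMeasurable).2 h
    have h3 := h2.integrableOn (s := Set.univ ×ˢ Set.Iic m)
    rw [IntegrableOn, ← Measure.prod_restrict, Measure.restrict_univ] at h3
    refine h3.congr (Filter.Eventually.of_forall ?_)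
    rintro ⟨u, w⟩
    simp [add_comm]

lemma goe_exp_deriv (q x : ℝ) :
    HasDerivAt (fun x : ℝ => Real.exp (-q * x ^ 2)) (Real.exp (-q * x ^ 2) * (-q * (2 * x))) x := by
  have := ((hasDerivAt_pow 2 x).const_mul (-q)).exp
  simpa using this

lemma goe_atBot {q : ℝ} (hq : 0 < q) (n : ℕ) :
    Filter.Tendsto (fun x : ℝ => x ^ n * Real.exp (-q * x ^ 2)) Filter.atBot (nhds 0) :=
  (goe_tendsto hq n).mono_left atBot_le_cocompact

lemma goe_atTop {q : ℝ} (hq : 0 < q) (n : ℕ) :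
    Filter.Tendsto (fun x : ℝ => x ^ n * Real.exp (-q * x ^ 2)) Filter.atTop (nhds 0) :=
  (goe_tendsto hq n).mono_left atTop_le_cocompact

lemma goe_inner_x (y z : ℝ) :
    ∫ x in Set.Iic y, Real.exp (-(1/2) * x ^ 2) * ((y - x) * (z - x))
      = (y * z + 1) * goeK (1/2) y + z * Real.exp (-(1/2) * y ^ 2) := by
  have h0 : (0:ℝ) < 1/2 := by norm_num
  have hd : ∀ x ∈ Set.Iic y, HasDerivAt (fun x => (y * z + 1) * goeK (1/2) x
      + (y + z) * Real.exp (-(1/2) * x ^ 2) - x * Real.exp (-(1/2) * x ^ 2))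
      (Real.exp (-(1/2) * x ^ 2) * ((y - x) * (z - x))) x := by
    intro x _
    have h := (((goeK_hasDerivAt h0 x).const_mul (y * z + 1)).add
      ((goe_exp_deriv (1/2) x).const_mul (y + z))).sub
      ((hasDerivAt_id x).mul (goe_exp_deriv (1/2) x))
    refine HasDerivAt.congr_deriv h ?_
    simp only [id]
    ring
  have hi : Integrable (fun x : ℝ => Real.exp (-(1/2) * x ^ 2) * ((y - x) * (z - x))) := by
    refine ((((goe_int h0 0).const_mul (y * z)).sub ((goe_int h0 1).const_mul (y + z))).add
      (goe_int h0 2)).congr (Filter.Eventually.of_forall fun x => ?_)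
    simp only [Pi.add_apply, Pi.sub_apply]
    ring
  rw [integral_Iic_of_hasDerivAt_of_tendsto' hd hi.integrableOn (m := 0)]
  · ring
  · have := (((goeK_bot (1/2)).const_mul (y * z + 1)).add
      ((goe_atBot h0 0).const_mul (y + z))).sub (goe_atBot h0 1)
    simpa using this

lemma goe_exp_half (y : ℝ) : Real.exp (-1 * y ^ 2) =
    Real.exp (-(1/2) * y ^ 2) * Real.exp (-(1/2) * y ^ 2) := by
  rw [← Real.exp_add]; congr 1; ring

lemma goe_inner_y (z : ℝ) :
    ∫ y in Set.Iic z, Real.exp (-(1/2) * y ^ 2) * ((z - y) *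
        ((y * z + 1) * goeK (1/2) y + z * Real.exp (-(1/2) * y ^ 2)))
      = (2 * z ^ 2 - 1) * goeK 1 z + z * Real.exp (-1 * z ^ 2)
        + Real.exp (-(1/2) * z ^ 2) * goeK (1/2) z := by
  have h0 : (0:ℝ) < 1/2 := by norm_num
  have h1 : (0:ℝ) < 1 := by norm_num
  have hd : ∀ y ∈ Set.Iic z, HasDerivAt (fun y => (2 * z ^ 2 - 1) * goeK 1 y
      + z * Real.exp (-1 * y ^ 2) + (z * y + (1 - z ^ 2)) * (Real.exp (-(1/2) * y ^ 2) * goeK (1/2) y))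
      (Real.exp (-(1/2) * y ^ 2) * ((z - y) *
        ((y * z + 1) * goeK (1/2) y + z * Real.exp (-(1/2) * y ^ 2)))) y := by
    intro y _
    have h := (((goeK_hasDerivAt h1 y).const_mul (2 * z ^ 2 - 1)).add
      ((goe_exp_deriv 1 y).const_mul z)).add
      ((((hasDerivAt_id y).const_mul z).add_const (1 - z ^ 2)).mul
        ((goe_exp_deriv (1/2) y).mul (goeK_hasDerivAt h0 y)))
    refine HasDerivAt.congr_deriv h ?_
    simp only [id, goe_exp_half, Pi.mul_apply]
    ring
  have hi : Integrable (fun y : ℝ => Real.exp (-(1/2) * y ^ 2) * ((z - y) *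
        ((y * z + 1) * goeK (1/2) y + z * Real.exp (-(1/2) * y ^ 2)))) := by
    refine ((goeK_mul_int h0 0 ((((goe_int h0 0).const_mul z).add
      ((goe_int h0 1).const_mul (z ^ 2 - 1))).sub ((goe_int h0 2).const_mul z))).add
      (((goe_int h1 0).const_mul (z ^ 2)).sub ((goe_int h1 1).const_mul z))).congr (Filter.Eventually.of_forall fun x => ?_)
    simp only [Pi.add_apply, Pi.sub_apply, goe_exp_half, add_zero]
    ring
  rw [integral_Iic_of_hasDerivAt_of_tendsto' hd hi.integrableOn (m := 0)]
  · ring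
  · have := (((goeK_bot 1).const_mul (2 * z ^ 2 - 1)).add
      ((goe_atBot h1 0).const_mul z)).add
      (goeK_mul_tendsto h0 0 (((goe_atBot h0 1).const_mul z).add
        ((goe_atBot h0 0).const_mul (1 - z ^ 2))) (by ring))
    simp only [mul_zero, add_zero] at this
    refine this.congr fun x => ?_
    ring

lemma goe_fubini {a : ℝ} (ha : 0 < a) (b : ℝ) :
    (∫ p in {p : ℝ × ℝ × ℝ | p.1 ≤ p.2.1 ∧ p.2.1 ≤ p.2.2},
        Real.exp (-(p.1 ^ 2 + p.2.1 ^ 2 + p.2.2 ^ 2) / 2)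
          * ((p.2.1 - p.1) * (p.2.2 - p.1) * (p.2.2 - p.2.1))
          * Real.exp (p.2.2 ^ 2 / 2 - a * (p.2.2 - b) ^ 2)) =
    ∫ z : ℝ, Real.exp (-a * (z - b) ^ 2) * ((2 * z ^ 2 - 1) * goeK 1 z + z * Real.exp (-1 * z ^ 2)
        + Real.exp (-(1/2) * z ^ 2) * goeK (1/2) z) := by
  have h0 : (0:ℝ) < 1/2 := by norm_num
  set S := {p : ℝ × ℝ × ℝ | p.1 ≤ p.2.1 ∧ p.2.1 ≤ p.2.2} with hS
  have hSm : MeasurableSet S :=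
    (measurableSet_le measurable_fst (measurable_fst.comp measurable_snd)).inter
      (measurableSet_le (measurable_fst.comp measurable_snd) (measurable_snd.comp measurable_snd))
  set f : ℝ × ℝ × ℝ → ℝ := fun p => Real.exp (-(1/2) * p.1 ^ 2) *
    (Real.exp (-(1/2) * p.2.1 ^ 2) * Real.exp (-a * (p.2.2 - b) ^ 2)) *
    ((p.2.1 - p.1) * (p.2.2 - p.1) * (p.2.2 - p.2.1)) with hf
  have hfe : ∀ p : ℝ × ℝ × ℝ, Real.exp (-(p.1 ^ 2 + p.2.1 ^ 2 + p.2.2 ^ 2) / 2)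
          * ((p.2.1 - p.1) * (p.2.2 - p.1) * (p.2.2 - p.2.1))
          * Real.exp (p.2.2 ^ 2 / 2 - a * (p.2.2 - b) ^ 2) = f p := by
    intro p
    rw [hf]
    simp only
    rw [mul_right_comm, ← Real.exp_add, ← Real.exp_add, ← Real.exp_add]
    congr 2
    ring
  simp only [hfe]
  have e0 : Integrable (fun z : ℝ => Real.exp (-a * (z - b) ^ 2)) := by
    simpa using (goe_int ha 0).comp_sub_right b
  have e1 : Integrable (fun z : ℝ => z * Real.exp (-a * (z - b) ^ 2)) := by
    refine (((goe_int ha 1).comp_sub_right b).add (e0.const_mul b)).congr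
      (Filter.Eventually.of_forall fun z => ?_)
    simp only [Pi.add_apply]
    ring
  have e2 : Integrable (fun z : ℝ => z ^ 2 * Real.exp (-a * (z - b) ^ 2)) := by
    refine ((((goe_int ha 2).comp_sub_right b).add (e1.const_mul (2 * b))).sub
      (e0.const_mul (b ^ 2))).congr (Filter.Eventually.of_forall fun z => ?_)
    simp only [Pi.add_apply, Pi.sub_apply]
    ring
  have g (n : ℕ) := goe_int h0 n
  have hfi : Integrable f := by
    have := ((((((g 0).mul_prod ((g 1).mul_prod e2)).sub
      ((g 0).mul_prod ((g 2).mul_prod e1))).sub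
      ((g 1).mul_prod ((g 0).mul_prod e2))).add
      ((g 2).mul_prod ((g 0).mul_prod e1))).add
      ((g 1).mul_prod ((g 2).mul_prod e0))).sub
      ((g 2).mul_prod ((g 1).mul_prod e0))
    refine this.congr (Filter.Eventually.of_forall fun p => ?_)
    simp only [Pi.add_apply, Pi.sub_apply, hf]
    ring
  have hI := hfi.indicator hSm
  rw [← integral_indicator hSm]
  have hin : ∀ y z : ℝ, ∫ x, S.indicator f (x, (y, z)) =
      (Set.Iic z).indicator (fun y => Real.exp (-a * (z - b) ^ 2) * (Real.exp (-(1/2) * y ^ 2) *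
        ((z - y) * ((y * z + 1) * goeK (1/2) y + z * Real.exp (-(1/2) * y ^ 2))))) y := by
    intro y z
    by_cases hyz : y ≤ z
    · rw [Set.indicator_of_mem (show y ∈ Set.Iic z from hyz), ← goe_inner_x,
        ← integral_indicator measurableSet_Iic, ← integral_const_mul, ← integral_const_mul,
        ← integral_const_mul]
      congr 1
      funext x
      by_cases hxy : x ≤ y
      · rw [Set.indicator_of_mem (show (x, (y, z)) ∈ S from ⟨hxy, hyz⟩),
          Set.indicator_of_mem (show x ∈ Set.Iic y from hxy)]
        simp only [hf]
        ring
      · rw [Set.indicator_of_notMem (show (x, (y, z)) ∉ S from fun h => hxy h.1),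
          Set.indicator_of_notMem (show x ∉ Set.Iic y from hxy)]
        ring
    · rw [Set.indicator_of_notMem (show y ∉ Set.Iic z from hyz)]
      have : ∀ x, S.indicator f (x, (y, z)) = 0 := fun x =>
        Set.indicator_of_notMem (show (x, (y, z)) ∉ S from fun h => hyz h.2) _
      simp [this]
  have hI2 : Integrable (fun w : ℝ × ℝ => ∫ x, S.indicator f (x, w)) := by
    have := hI.integral_prod_right
    exact this
  have s1 : ∫ p, S.indicator f p = ∫ w : ℝ × ℝ, ∫ x : ℝ, S.indicator f (x, w) :=
    integral_prod_symm _ hI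
  have s2 : ∫ w : ℝ × ℝ, ∫ x : ℝ, S.indicator f (x, w)
      = ∫ z : ℝ, ∫ y : ℝ, ∫ x : ℝ, S.indicator f (x, (y, z)) :=
    integral_prod_symm _ hI2
  rw [s1, s2]
  congr 1
  funext z
  simp only [hin]
  rw [integral_indicator measurableSet_Iic, integral_const_mul, goe_inner_y]

lemma goe_outer {a : ℝ} (ha : 0 < a) (b : ℝ) :
    ∫ z : ℝ, Real.exp (-a * (z - b) ^ 2) * ((2 * z ^ 2 - 1) * goeK 1 z + z * Real.exp (-1 * z ^ 2)
        + Real.exp (-(1/2) * z ^ 2) * goeK (1/2) z)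
    = (1 / a + 2 * b ^ 2 - 1) * (√(π / (a + 1)) * goeK (a * 1 / (a + 1)) b)
      + b * (a + 1) / a * (√(π / (a + 1)) * Real.exp (-(a * 1 / (a + 1)) * b ^ 2))
      + Real.exp (-a * b ^ 2 / (2 * a + 1)) * (√(π / (a + 1/2 + 1/2)) *
          goeK ((a + 1/2) * (1/2) / (a + 1/2 + 1/2)) (2 * a * b / (2 * a + 1))) := by
  have h0 : (0:ℝ) < 1/2 := by norm_num
  have h1 : (0:ℝ) < 1 := by norm_num
  rw [← integral_add_right_eq_self _ b]
  have gb : ∀ {q : ℝ}, 0 < q → ∀ {f : ℝ → ℝ}, Integrable f →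
      Integrable (fun u => f u * Real.exp (-q * (b + u) ^ 2)) := by
    intro q hq f hf
    refine hf.mul_bdd (c := 1) (Continuous.aestronglyMeasurable (by fun_prop))
      (Filter.Eventually.of_forall fun u => ?_)
    rw [Real.norm_of_nonneg (by positivity), Real.exp_le_one_iff]
    nlinarith [sq_nonneg (b + u)]
  have gt : ∀ {l : Filter ℝ} {f : ℝ → ℝ}, Filter.Tendsto f l (nhds 0) →
      Filter.Tendsto (fun u => f u * Real.exp (-1 * (b + u) ^ 2)) l (nhds 0) := by
    intro l f hf
    apply hf.zero_mul_isBoundedUnder_le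
    refine Filter.isBoundedUnder_of ⟨1, fun u => ?_⟩
    simp only [Function.comp]
    rw [Real.norm_of_nonneg (by positivity), Real.exp_le_one_iff]
    nlinarith [sq_nonneg (b + u)]
  let D : ℝ → ℝ := fun u => (-(1 / a) * (u ^ 1 * Real.exp (-a * u ^ 2))
      + -(2 * b / a) * (u ^ 0 * Real.exp (-a * u ^ 2))) * goeK 1 (u + b)
      - 1 / (2 * a) * (u ^ 0 * Real.exp (-a * u ^ 2) * Real.exp (-1 * (b + u) ^ 2))
  let D' : ℝ → ℝ := fun u => (2 * (u ^ 2 * Real.exp (-a * u ^ 2))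
      + 4 * b * (u ^ 1 * Real.exp (-a * u ^ 2))
      - 1 / a * (u ^ 0 * Real.exp (-a * u ^ 2))) * goeK 1 (u + b)
      + (u ^ 1 * Real.exp (-a * u ^ 2) * Real.exp (-1 * (b + u) ^ 2)
      + (-(b / a)) * (u ^ 0 * Real.exp (-a * u ^ 2) * Real.exp (-1 * (b + u) ^ 2)))
  have hDD : ∀ u, HasDerivAt D (D' u) u := by
    intro u
    have hE := goe_exp_deriv a u
    have hu := (hasDerivAt_id u).mul hE
    have hK := (goeK_hasDerivAt h1 (u + b)).comp_add_const u b
    have hg := (goe_exp_deriv 1 (b + u)).comp_const_add b u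
    have h := (((hu.const_mul (-(1 / a))).add (hE.const_mul (-(2 * b / a)))).mul hK).sub
      ((hE.mul hg).const_mul (1 / (2 * a)))
    have hD : D = fun u => (-(1 / a) * (u * Real.exp (-a * u ^ 2))
      + -(2 * b / a) * (Real.exp (-a * u ^ 2))) * goeK 1 (u + b)
      - 1 / (2 * a) * (Real.exp (-a * u ^ 2) * Real.exp (-1 * (b + u) ^ 2)) := by
      funext u
      simp [D]
    rw [hD]
    refine HasDerivAt.congr_deriv h ?_
    simp only [D', id, Pi.mul_apply, Pi.add_apply, add_comm u b]
    field_simp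
    ring
  have hD'i : Integrable D' :=
    (goeK_mul_int h1 b ((((goe_int ha 2).const_mul 2).add ((goe_int ha 1).const_mul (4 * b))).sub
      ((goe_int ha 0).const_mul (1 / a)))).add
      ((gb h1 (goe_int ha 1)).add ((gb h1 (goe_int ha 0)).const_mul (-(b / a))))
  have hDt : ∀ l : Filter ℝ, l ≤ Filter.cocompact ℝ → Filter.Tendsto D l (nhds 0) := by
    intro l hl
    have t (n : ℕ) := (goe_tendsto ha n).mono_left hl
    have := (goeK_mul_tendsto h1 b (((t 1).const_mul (-(1 / a))).add
      ((t 0).const_mul (-(2 * b / a)))) (by ring)).sub ((gt (t 0)).const_mul (1 / (2 * a)))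
    simpa [D] using this
  have hD0 : ∫ u, D' u = 0 := by
    rw [integral_of_hasDerivAt_of_tendsto hDD hD'i (hDt _ atBot_le_cocompact)
      (hDt _ atTop_le_cocompact), sub_zero]
  have hi0 := integrable_exp_neg_mul_sq ha
  have i1 := (goeK_mul_int h1 b hi0).const_mul (1 / a + 2 * b ^ 2 - 1)
  have i2 := (gb h1 hi0).const_mul (b * (a + 1) / a)
  have i3 := goeK_mul_int h0 b (gb h0 hi0)
  have hpt : ∀ u : ℝ, Real.exp (-a * (u + b - b) ^ 2) * ((2 * (u + b) ^ 2 - 1) * goeK 1 (u + b)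
        + (u + b) * Real.exp (-1 * (u + b) ^ 2)
        + Real.exp (-(1/2) * (u + b) ^ 2) * goeK (1/2) (u + b))
      = D' u + (1 / a + 2 * b ^ 2 - 1) * (Real.exp (-a * u ^ 2) * goeK 1 (u + b))
        + b * (a + 1) / a * (Real.exp (-a * u ^ 2) * Real.exp (-1 * (b + u) ^ 2))
        + Real.exp (-a * u ^ 2) * Real.exp (-(1/2) * (b + u) ^ 2) * goeK (1/2) (u + b) := by
    intro u
    simp only [D', add_sub_cancel_right, add_comm u b]
    field_simp
    ring
  simp only [hpt]
  have i3' : ∫ u, Real.exp (-a * u ^ 2) * Real.exp (-(1/2) * (b + u) ^ 2) * goeK (1/2) (u + b)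
      = Real.exp (-a * b ^ 2 / (2 * a + 1)) * (√(π / (a + 1/2 + 1/2)) *
          goeK ((a + 1/2) * (1/2) / (a + 1/2 + 1/2)) (2 * a * b / (2 * a + 1))) := by
    rw [← goe_key (by positivity) h0, ← integral_const_mul,
      ← integral_add_right_eq_self (fun u => Real.exp (-a * b ^ 2 / (2 * a + 1)) *
        (Real.exp (-(a + 1/2) * u ^ 2) * goeK (1/2) (u + 2 * a * b / (2 * a + 1))))
        (b / (2 * a + 1))]
    congr 1
    funext u
    have h2 : 2 * a + 1 ≠ 0 := by positivity
    have e1 : u + b / (2 * a + 1) + 2 * a * b / (2 * a + 1) = u + b := by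
      field_simp
      ring
    rw [e1, ← mul_assoc, ← Real.exp_add, ← Real.exp_add]
    congr 2
    field_simp
    ring
  have step1 := integral_add ((hD'i.add i1).add i2) i3
  have step2 := integral_add (hD'i.add i1) i2
  have step3 := integral_add hD'i i1
  simp only [Pi.add_apply] at step1 step2 step3
  rw [step1, step2, step3, hD0, i3', integral_const_mul, integral_const_mul, goe_key ha h1,
    goe_sq_int ha h1, zero_add]

/-- The GOE expectation `E_{GOE}^3[exp(λ₃²/2 − a(λ₃−b)²)]` over the ordered eigenvalue
density of the 3×3 GOE, computed in closed form (Proposition for `N = 2`). -/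
theorem goe3_expectation (a b : ℝ) (ha : 0 < a) (hb : 0 < b) (Φ : ℝ → ℝ)
    (hΦ : ∀ x, Φ x = ∫ t in Set.Iic x, (Real.sqrt (2 * π))⁻¹ * Real.exp (-t ^ 2 / 2))
    (c₃ : ℝ)
    (hc₃ : c₃ = (1 / 6) * (2 * Real.sqrt 2) ^ 3
        * (Real.Gamma (3 / 2) * Real.Gamma 2 * Real.Gamma (5 / 2))) :
    c₃⁻¹ * (∫ p in {p : ℝ × ℝ × ℝ | p.1 ≤ p.2.1 ∧ p.2.1 ≤ p.2.2},
        Real.exp (-(p.1 ^ 2 + p.2.1 ^ 2 + p.2.2 ^ 2) / 2)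
          * ((p.2.1 - p.1) * (p.2.2 - p.1) * (p.2.2 - p.2.1))
          * Real.exp (p.2.2 ^ 2 / 2 - a * (p.2.2 - b) ^ 2)) =
      (1 / (Real.sqrt 2 * π)) *
        ((1 / a + 2 * b ^ 2 - 1) * (π / Real.sqrt a) * Φ (b * Real.sqrt (2 * a) / Real.sqrt (a + 1))
          + b * Real.sqrt (a + 1) * Real.sqrt π / a * Real.exp (-a * b ^ 2 / (a + 1))
          + 2 * π / Real.sqrt (2 * a + 1) * Real.exp (-a * b ^ 2 / (2 * a + 1))
              * Φ (Real.sqrt 2 * a * b / Real.sqrt ((2 * a + 1) * (a + 1)))) := by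
  have hc : c₃ = √2 * π := by
    have g1 : Real.Gamma (3 / 2) = √π / 2 := by
      rw [show (3 / 2 : ℝ) = 1 / 2 + 1 by norm_num, Real.Gamma_add_one (by norm_num),
        Real.Gamma_one_half_eq]
      ring
    have g2 : Real.Gamma (5 / 2) = 3 * √π / 4 := by
      rw [show (5 / 2 : ℝ) = 3 / 2 + 1 by norm_num, Real.Gamma_add_one (by norm_num), g1]
      ring
    have h2 : √2 ^ 3 = 2 * √2 := by
      rw [pow_succ, Real.sq_sqrt (by norm_num)]
    have hp : √π * √π = π := Real.mul_self_sqrt pi_pos.le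
    rw [hc₃, g1, g2, Real.Gamma_two, mul_pow, h2]
    linear_combination (√2) * hp
  have hpp : √π * √π = π := Real.mul_self_sqrt pi_pos.le
  rw [goe_fubini ha b, goe_outer ha b, goeK_phi Φ hΦ (by positivity), goeK_phi Φ hΦ (by positivity),
    hc, one_div (√2 * π)]
  have hA : 0 < √(a + 1) := by positivity
  have hAA : √(a + 1) * √(a + 1) = a + 1 := Real.mul_self_sqrt (by positivity)
  have T1 : √(π / (a + 1)) * √(π / (a * 1 / (a + 1))) = π / √a := by
    rw [← Real.sqrt_mul (by positivity),
      show π / (a + 1) * (π / (a * 1 / (a + 1))) = π ^ 2 / a by field_simp,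
      Real.sqrt_div (by positivity), Real.sqrt_sq pi_pos.le]
  have A1 : b * √(2 * (a * 1 / (a + 1))) = b * √(2 * a) / √(a + 1) := by
    rw [mul_div_assoc b, ← Real.sqrt_div (by positivity)]
    congr 2
    ring
  have T2 : b * (a + 1) / a * √(π / (a + 1)) = b * √(a + 1) * √π / a := by
    rw [Real.sqrt_div pi_pos.le]
    field_simp
    linear_combination (-1 : ℝ) * hAA
  have X2 : -(a * 1 / (a + 1)) * b ^ 2 = -a * b ^ 2 / (a + 1) := by ring
  have T3 : √(π / (a + 1/2 + 1/2)) * √(π / ((a + 1/2) * (1/2) / (a + 1/2 + 1/2)))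
      = 2 * π / √(2 * a + 1) := by
    have : 2 * a + 1 ≠ 0 := by positivity
    have : a + 1/2 ≠ 0 := by positivity
    rw [← Real.sqrt_mul (by positivity),
      show π / (a + 1/2 + 1/2) * (π / ((a + 1/2) * (1/2) / (a + 1/2 + 1/2)))
        = (2 * π) ^ 2 / (2 * a + 1) by field_simp,
      Real.sqrt_div (by positivity), Real.sqrt_sq (by positivity)]
  have A3 : 2 * a * b / (2 * a + 1) * √(2 * ((a + 1/2) * (1/2) / (a + 1/2 + 1/2)))
      = √2 * a * b / √((2 * a + 1) * (a + 1)) := by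
    rw [show 2 * ((a + 1/2) * (1/2) / (a + 1/2 + 1/2)) = (2 * a + 1) / (2 * (a + 1)) by
        field_simp; ring,
      Real.sqrt_div (by positivity), Real.sqrt_mul (by positivity), Real.sqrt_mul (by positivity)]
    have h2 : √2 ^ 2 = 2 := Real.sq_sqrt (by norm_num)
    have h3 : √(2 * a + 1) ^ 2 = 2 * a + 1 := Real.sq_sqrt (by positivity)
    have : 0 < √(2 * a + 1) := by positivity
    field_simp
    rw [h2, h3]
    ring
  rw [A1, A3, X2, ← T1, ← T2, ← T3]
  ring
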